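/- Let 0 < φ < θ < π. For every unit quaternion z, dS(z, e^{−iθ} z e^{iφ}) ≤ Real.arccos(cos θ cos φ − sin θ sin φ), with equality if and only if z lies on the great circle through j and k, i.e., z = j cos t + k sin t for some t ∈ ℝ. Consequently the set of points of the diagonal △ = {(x, x)} farthest from Σ = {(y, e^{iθ} y e^{−iφ})} (the cold set) is the great circle {(j cos t + k sin t, j cos t + k sin t) : t ∈ ℝ}. -/

import Mathlib

open Quaternion

/-- The first quaternion imaginary unit `i`. -/
noncomputable def qi : ℍ[ℝ] := ⟨0, 1, 0, 0⟩

/-- `e^{it} = cos t + i sin t` as a quaternion. -/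
noncomputable def eI (t : ℝ) : ℍ[ℝ] := (Real.cos t : ℍ[ℝ]) + (Real.sin t : ℍ[ℝ]) * qi

/-- The point `j cos t + k sin t` on the great circle through `j` and `k`. -/
noncomputable def jk (t : ℝ) : ℍ[ℝ] := ⟨0, 0, Real.cos t, Real.sin t⟩

/-- Geodesic distance on the unit 3-sphere of quaternions: `dS(a,b) = arccos ⟪a, b⟫` where
`⟪a, b⟫ = re(a * star b)`. -/
noncomputable def dS (a b : ℍ[ℝ]) : ℝ := Real.arccos (a * star b).re

/-- Distance in the product metric from the diagonal point `(z, z)` to the great 3-sphere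
`Σ = {(y, e^{iθ} y e^{−iφ})}`. -/
noncomputable def dDiag (θ φ : ℝ) (z : ℍ[ℝ]) : ℝ :=
  sInf {v : ℝ | ∃ y : ℍ[ℝ], ‖y‖ = 1 ∧
    v = Real.sqrt (dS z y ^ 2 + dS z (eI θ * y * eI (-φ)) ^ 2)}

open InnerProductGeometry in
lemma dS_eq_angle (a b : ℍ[ℝ]) (ha : ‖a‖ = 1) (hb : ‖b‖ = 1) : dS a b = angle a b := by
  unfold dS angle
  rw [ha, hb, Quaternion.inner_def]; simp

lemma sq_of_norm (z : ℍ[ℝ]) (hz : ‖z‖ = 1) : z.re^2 + z.imI^2 + z.imJ^2 + z.imK^2 = 1 := by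
  have h := Quaternion.normSq_eq_norm_mul_self z
  rw [hz, Quaternion.normSq_def'] at h
  linarith

lemma norm_of_sq (z : ℍ[ℝ]) (h : z.re^2 + z.imI^2 + z.imJ^2 + z.imK^2 = 1) : ‖z‖ = 1 := by
  have h' := Quaternion.normSq_eq_norm_mul_self z
  rw [Quaternion.normSq_def', h] at h'
  nlinarith [norm_nonneg z]

lemma qi_re : qi.re = 0 := rfl
lemma qi_imI : qi.imI = 1 := rfl
lemma qi_imJ : qi.imJ = 0 := rfl
lemma qi_imK : qi.imK = 0 := rfl
lemma eI_re (t : ℝ) : (eI t).re = Real.cos t := by simp [eI, qi_re, qi_imI, qi_imJ, qi_imK]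
lemma eI_imI (t : ℝ) : (eI t).imI = Real.sin t := by simp [eI, qi_re, qi_imI, qi_imJ, qi_imK]
lemma eI_imJ (t : ℝ) : (eI t).imJ = 0 := by simp [eI, qi_re, qi_imI, qi_imJ, qi_imK]
lemma eI_imK (t : ℝ) : (eI t).imK = 0 := by simp [eI, qi_re, qi_imI, qi_imJ, qi_imK]

lemma norm_eI (t : ℝ) : ‖eI t‖ = 1 := by
  apply norm_of_sq
  simp [eI_re, eI_imI, eI_imJ, eI_imK]

lemma norm_jk (t : ℝ) : ‖jk t‖ = 1 := by
  apply norm_of_sq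
  simp [jk]

lemma inner_rot (θ φ : ℝ) (z : ℍ[ℝ]) :
    (z * star (eI (-θ) * z * eI φ)).re =
      (z.re^2 + z.imI^2) * (Real.cos θ * Real.cos φ + Real.sin θ * Real.sin φ) +
      (z.imJ^2 + z.imK^2) * (Real.cos θ * Real.cos φ - Real.sin θ * Real.sin φ) := by
  simp [eI_re, eI_imI, eI_imJ, eI_imK]
  ring

lemma inner_adj (θ φ : ℝ) (z y : ℍ[ℝ]) :
    (z * star (eI θ * y * eI (-φ))).re = ((eI (-θ) * z * eI φ) * star y).re := by
  simp [eI_re, eI_imI, eI_imJ, eI_imK]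
  ring

lemma dS_adj (θ φ : ℝ) (z y : ℍ[ℝ]) :
    dS z (eI θ * y * eI (-φ)) = dS (eI (-θ) * z * eI φ) y := by
  unfold dS; rw [inner_adj]

lemma dS_comm' (a b : ℍ[ℝ]) : dS a b = dS b a := by
  unfold dS
  rw [← Quaternion.inner_def, ← Quaternion.inner_def, real_inner_comm]

lemma exists_mid (z w : ℍ[ℝ]) (hz : ‖z‖ = 1) (hw : ‖w‖ = 1) :
    ∃ y : ℍ[ℝ], ‖y‖ = 1 ∧ dS z y = dS z w / 2 ∧ dS w y = dS z w / 2 := by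
  set c : ℝ := inner ℝ z w with hc
  have hcd : dS z w = Real.arccos c := by unfold dS; rw [hc, Quaternion.inner_def]
  have hab : |c| ≤ 1 := by
    have := abs_real_inner_le_norm z w
    rwa [hz, hw, one_mul] at this
  obtain ⟨h1, h2⟩ := abs_le.1 hab
  have hn : ‖z + w‖^2 = 2 + 2 * c := by
    rw [norm_add_sq_real, hz, hw]; ring
  have hzz : inner ℝ z z = (1:ℝ) := by rw [real_inner_self_eq_norm_sq, hz]; norm_num
  have hww : inner ℝ w w = (1:ℝ) := by rw [real_inner_self_eq_norm_sq, hw]; norm_num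
  rcases h1.eq_or_lt with h | h
  · have hzw : z + w = 0 := by
      rw [← norm_eq_zero, ← sq_eq_zero_iff, hn, ← h]; norm_num
    have hw' : w = -z := (neg_eq_of_add_eq_zero_right hzw).symm
    refine ⟨z * qi, ?_, ?_, ?_⟩
    · rw [norm_mul, hz, one_mul]
      apply norm_of_sq; simp [qi_re, qi_imI, qi_imJ, qi_imK]
    · rw [hcd, ← h, Real.arccos_neg_one, ← Real.arccos_zero]
      unfold dS; congr 1; simp [qi_re, qi_imI, qi_imJ, qi_imK]; ring
    · rw [hcd, ← h, Real.arccos_neg_one, ← Real.arccos_zero, hw']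
      unfold dS; congr 1; simp [qi_re, qi_imI, qi_imJ, qi_imK]; ring
  · set δ := Real.arccos c with hδ
    have hcos : Real.cos δ = c := Real.cos_arccos h1 h2
    have hδ0 : 0 ≤ δ := Real.arccos_nonneg _
    have hδp : δ ≤ Real.pi := Real.arccos_le_pi _
    have hC : c = 2 * Real.cos (δ/2)^2 - 1 := by
      rw [← hcos, ← Real.cos_two_mul]; congr 1; ring
    have hC0 : 0 ≤ Real.cos (δ/2) := Real.cos_nonneg_of_mem_Icc ⟨by linarith, by linarith⟩
    have hCp : 0 < Real.cos (δ/2) := by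
      rcases hC0.eq_or_lt with h0 | h0
      · rw [← h0] at hC; linarith
      · exact h0
    have hac : Real.arccos (Real.cos (δ/2)) = δ/2 :=
      Real.arccos_cos (by linarith) (by linarith)
    set C := Real.cos (δ/2)
    have hnn : ‖z + w‖ = 2 * C := by
      have : ‖z + w‖^2 = (2*C)^2 := by rw [hn, hC]; ring
      exact (sq_eq_sq₀ (norm_nonneg _) (by linarith)).1 this
    refine ⟨(2*C)⁻¹ • (z + w), ?_, ?_, ?_⟩
    · rw [norm_smul, hnn, norm_inv, Real.norm_of_nonneg (by linarith)]
      field_simp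
    · rw [hcd, ← hac]; unfold dS; congr 1
      rw [← Quaternion.inner_def, inner_smul_right, inner_add_right, hzz, ← hc, hC]
      field_simp; ring
    · rw [hcd, ← hac]; unfold dS; congr 1
      rw [← Quaternion.inner_def, inner_smul_right, inner_add_right, hww, real_inner_comm, ← hc, hC]
      field_simp; ring

lemma dDiag_eq (θ φ : ℝ) (z : ℍ[ℝ]) (hz : ‖z‖ = 1) :
    dDiag θ φ z = Real.sqrt (dS z (eI (-θ) * z * eI φ) ^ 2 / 2) := by
  have hw : ‖eI (-θ) * z * eI φ‖ = 1 := by simp [norm_mul, norm_eI, hz]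
  unfold dDiag
  simp only [dS_adj]
  set w := eI (-θ) * z * eI φ
  apply IsLeast.csInf_eq
  constructor
  · obtain ⟨y, hy, h1, h2⟩ := exists_mid z w hz hw
    refine ⟨y, hy, ?_⟩
    rw [h1, h2]; congr 1; ring
  · rintro v ⟨y, hy, rfl⟩
    apply Real.sqrt_le_sqrt
    have ht : dS z w ≤ dS z y + dS w y := by
      rw [dS_comm' w y, dS_eq_angle _ _ hz hw, dS_eq_angle _ _ hz hy, dS_eq_angle _ _ hy hw]
      exact InnerProductGeometry.angle_le_angle_add_angle _ _ _
    have h0 : 0 ≤ dS z w := Real.arccos_nonneg _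
    nlinarith [sq_nonneg (dS z y - dS w y)]

/-- For `0 < φ < θ < π` and every unit quaternion `z`,
`dS(z, e^{−iθ} z e^{iφ}) ≤ arccos(cos θ cos φ − sin θ sin φ)`, with equality iff
`z = j cos t + k sin t` for some `t`.  Consequently the cold set of the diagonal relative
to `Σ = {(y, e^{iθ} y e^{−iφ})}` is the great circle `{(j cos t + k sin t, j cos t + k sin t)}`. -/
theorem cold_circle (θ φ : ℝ) (hφ : 0 < φ) (hφθ : φ < θ) (hθ : θ < Real.pi) :
    (∀ z : ℍ[ℝ], ‖z‖ = 1 →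
      dS z (eI (-θ) * z * eI φ) ≤
          Real.arccos (Real.cos θ * Real.cos φ - Real.sin θ * Real.sin φ) ∧
      (dS z (eI (-θ) * z * eI φ) =
          Real.arccos (Real.cos θ * Real.cos φ - Real.sin θ * Real.sin φ) ↔
        ∃ t : ℝ, z = jk t)) ∧
    (∀ z : ℍ[ℝ], ‖z‖ = 1 →
      ((∀ w : ℍ[ℝ], ‖w‖ = 1 → dDiag θ φ w ≤ dDiag θ φ z) ↔ ∃ t : ℝ, z = jk t)) := by
  have hs1 : 0 < Real.sin θ := Real.sin_pos_of_pos_of_lt_pi (by linarith) hθ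
  have hs2 : 0 < Real.sin φ := Real.sin_pos_of_pos_of_lt_pi hφ (by linarith)
  have hs := mul_pos hs1 hs2
  have key : (∀ z : ℍ[ℝ], ‖z‖ = 1 →
      dS z (eI (-θ) * z * eI φ) ≤
          Real.arccos (Real.cos θ * Real.cos φ - Real.sin θ * Real.sin φ) ∧
      (dS z (eI (-θ) * z * eI φ) =
          Real.arccos (Real.cos θ * Real.cos φ - Real.sin θ * Real.sin φ) ↔
        ∃ t : ℝ, z = jk t)) := by
    intro z hz
    have hq := sq_of_norm z hz
    have hI := inner_rot θ φ z
    have hI' : (z * star (eI (-θ) * z * eI φ)).re =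
      (Real.cos θ * Real.cos φ - Real.sin θ * Real.sin φ) +
        2 * (z.re^2 + z.imI^2) * (Real.sin θ * Real.sin φ) := by
      rw [hI]
      linear_combination (Real.cos θ * Real.cos φ - Real.sin θ * Real.sin φ) * hq
    refine ⟨?_, ?_, ?_⟩
    · unfold dS
      apply Real.arccos_le_arccos
      rw [hI']
      have : 0 ≤ 2 * (z.re^2 + z.imI^2) * (Real.sin θ * Real.sin φ) := by positivity
      linarith
    · intro h
      have hw : ‖eI (-θ) * z * eI φ‖ = 1 := by simp [norm_mul, norm_eI, hz]
      have hab := abs_real_inner_le_norm z (eI (-θ) * z * eI φ)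
      rw [hz, hw, one_mul, Quaternion.inner_def, abs_le] at hab
      unfold dS at h
      have h2 := Real.arccos_injOn (Set.mem_Icc.2 hab) (by
        rw [← Real.cos_add]
        exact ⟨Real.neg_one_le_cos _, Real.cos_le_one _⟩) h
      rw [hI'] at h2
      have h3 : (z.re^2 + z.imI^2) * (Real.sin θ * Real.sin φ) = 0 := by linarith
      have h4 : z.re^2 + z.imI^2 = 0 := (mul_eq_zero.1 h3).resolve_right hs.ne'
      have hre : z.re = 0 := by nlinarith [sq_nonneg z.re, sq_nonneg z.imI]
      have him : z.imI = 0 := by nlinarith [sq_nonneg z.re, sq_nonneg z.imI]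
      have h5 : z.imJ^2 + z.imK^2 = 1 := by linarith
      have hn : ‖(⟨z.imJ, z.imK⟩ : ℂ)‖ = 1 := by
        have := Complex.sq_norm (⟨z.imJ, z.imK⟩ : ℂ)
        rw [Complex.normSq_mk] at this
        nlinarith [norm_nonneg (⟨z.imJ, z.imK⟩ : ℂ)]
      refine ⟨Complex.arg ⟨z.imJ, z.imK⟩, ?_⟩
      have e1 := Complex.norm_mul_cos_arg (⟨z.imJ, z.imK⟩ : ℂ)
      have e2 := Complex.norm_mul_sin_arg (⟨z.imJ, z.imK⟩ : ℂ)
      rw [hn, one_mul] at e1 e2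
      ext <;> simp [jk, hre, him, e1, e2]
    · rintro ⟨t, rfl⟩
      unfold dS
      rw [hI']
      simp [jk]
  refine ⟨key, ?_⟩
  intro z hz
  constructor
  · intro h
    have h1 := h (jk 0) (norm_jk 0)
    rw [dDiag_eq _ _ _ hz, dDiag_eq _ _ _ (norm_jk 0),
      ((key (jk 0) (norm_jk 0)).2).2 ⟨0, rfl⟩,
      Real.sqrt_le_sqrt_iff (by positivity)] at h1
    refine (key z hz).2.1 (le_antisymm (key z hz).1 ?_)
    have h0 : 0 ≤ dS z (eI (-θ) * z * eI φ) := Real.arccos_nonneg _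
    exact abs_le_of_sq_le_sq' (by linarith) h0 |>.2
  · intro h w hw
    rw [dDiag_eq _ _ _ hz, dDiag_eq _ _ _ hw, (key z hz).2.2 h]
    apply Real.sqrt_le_sqrt
    have h0 : 0 ≤ dS w (eI (-θ) * w * eI φ) := Real.arccos_nonneg _
    have := pow_le_pow_left₀ h0 (key w hw).1 2
    linarith
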